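/- arXiv:1910.06201 — 5 statements merged into one kernel-verified Lean document; each statement's English description precedes it below -/
import Mathlib

section
/- If G is a finite simple graph containing no induced copy of the 4-cycle C_4 and no induced copy of the path P_5 on five vertices, then every Maxine run on G produces a maximum independent set, i.e., the final vertex set has size α(G). -/
open SimpleGraph Finset

variable {V : Type*}

/-- The number of neighbours of `x` inside the vertex set `A`
(i.e. the degree of `x` towards `A`, which for `x ∈ A` is its degree
in the subgraph induced on `A`). -/
noncomputable def degIn (G : SimpleGraph V) (A : Finset V) (x : V) : ℕ :=
  {y ∈ (A : Set V) | G.Adj x y}.ncard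

/-- `s` is an independent set of vertices: pairwise nonadjacent. -/
def IsIndepF (G : SimpleGraph V) (s : Finset V) : Prop :=
  ∀ a ∈ s, ∀ b ∈ s, ¬ G.Adj a b

/-- The independence number of the subgraph of `G` induced on `A`:
the maximum size of an independent set contained in `A`. -/
noncomputable def indepNumOn (G : SimpleGraph V) (A : Finset V) : ℕ :=
  sSup {n | ∃ s : Finset V, s ⊆ A ∧ IsIndepF G s ∧ s.card = n}

/-- `s` is a maximum independent set of the subgraph of `G` induced on `A`. -/
def MaxIndepOn (G : SimpleGraph V) (A s : Finset V) : Prop :=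
  s ⊆ A ∧ IsIndepF G s ∧ s.card = indepNumOn G A

/-- A Maxine run on `G`: starting from the whole vertex set, while an edge remains,
repeatedly delete a vertex of maximum degree of the current induced subgraph,
ending in an edgeless (independent) vertex set `A t`. -/
structure MaxineRun (G : SimpleGraph V) [Fintype V] [DecidableEq V] where
  t : ℕ
  A : ℕ → Finset V
  del : ℕ → V
  init : A 0 = Finset.univ
  hasEdge : ∀ i < t, ∃ x ∈ A i, ∃ y ∈ A i, G.Adj x y
  mem_del : ∀ i < t, del i ∈ A i
  maxdeg : ∀ i < t, ∀ y ∈ A i, degIn G (A i) y ≤ degIn G (A i) (del i)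
  step : ∀ i < t, A (i + 1) = (A i).erase (del i)
  final : ∀ x ∈ A t, ∀ y ∈ A t, ¬ G.Adj x y

theorem nonempty_cycleGraph_four_embedding {G : SimpleGraph V} {a b c d : V}
    (hab : G.Adj a b) (hbc : G.Adj b c) (hcd : G.Adj c d) (hda : G.Adj d a)
    (hac : ¬ G.Adj a c) (hbd : ¬ G.Adj b d) (nac : a ≠ c) (nbd : b ≠ d) :
    Nonempty (cycleGraph 4 ↪g G) := by
  refine ⟨⟨⟨![a, b, c, d], ?_⟩, ?_⟩⟩
  · intro i j h
    have := hab.ne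
    have := hbc.ne
    have := hcd.ne
    have := hda.ne
    fin_cases i <;> fin_cases j <;> simp_all
  · intro i j
    change G.Adj (![a, b, c, d] i) (![a, b, c, d] j) ↔ _
    fin_cases i <;> fin_cases j <;>
      simp [cycleGraph_adj, hab, hbc, hcd, hda, hab.symm, hbc.symm, hcd.symm, hda.symm,
        hac, hbd, G.adj_comm c a, G.adj_comm d b] <;> decide

theorem nonempty_pathGraph_five_embedding {G : SimpleGraph V} {a b c d e : V}
    (hab : G.Adj a b) (hbc : G.Adj b c) (hcd : G.Adj c d) (hde : G.Adj d e)
    (hac : ¬ G.Adj a c) (had : ¬ G.Adj a d) (hae : ¬ G.Adj a e)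
    (hbd : ¬ G.Adj b d) (hbe : ¬ G.Adj b e) (hce : ¬ G.Adj c e) :
    Nonempty (pathGraph 5 ↪g G) := by
  have nab := hab.ne
  have nbc := hbc.ne
  have ncd := hcd.ne
  have nde := hde.ne
  have nac : a ≠ c := by rintro rfl; exact had hcd
  have nad : a ≠ d := by rintro rfl; exact hae hde
  have nae : a ≠ e := by rintro rfl; exact hbe hab.symm
  have nbd : b ≠ d := by rintro rfl; exact had hab
  have nbe : b ≠ e := by rintro rfl; exact hae hab
  have nce : c ≠ e := by rintro rfl; exact hbe hbc
  refine ⟨⟨⟨![a, b, c, d, e], ?_⟩, ?_⟩⟩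
  · intro i j h
    fin_cases i <;> fin_cases j <;> simp_all
  · intro i j
    change G.Adj (![a, b, c, d, e] i) (![a, b, c, d, e] j) ↔ _
    fin_cases i <;> fin_cases j <;>
      simp [pathGraph_adj, hab, hbc, hcd, hde, hab.symm, hbc.symm, hcd.symm, hde.symm,
        hac, had, hae, hbd, hbe, hce, G.adj_comm c a, G.adj_comm d a, G.adj_comm e a,
        G.adj_comm d b, G.adj_comm e b, G.adj_comm e c]

open Classical in
theorem degIn_eq_card_filter (G : SimpleGraph V) (A : Finset V) (x : V) :
    degIn G A x = #{y ∈ A | G.Adj x y} := by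
  rw [degIn, ← Set.ncard_coe_finset]
  congr 1
  ext y
  simp

/-- Deleting a vertex of maximum degree from a `{C₄, P₅}`-free graph with an edge
does not decrease the independence number. -/
theorem exists_isIndepF_subset_erase [DecidableEq V] {G : SimpleGraph V}
    (hC4 : ¬ Nonempty (cycleGraph 4 ↪g G)) (hP5 : ¬ Nonempty (pathGraph 5 ↪g G))
    {A s : Finset V} {v : V} (hedge : ∃ x ∈ A, ∃ y ∈ A, G.Adj x y) (hv : v ∈ A)
    (hmax : ∀ y ∈ A, degIn G A y ≤ degIn G A v) (hsA : s ⊆ A) (hs : IsIndepF G s) :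
    ∃ s' ⊆ A.erase v, IsIndepF G s' ∧ s.card ≤ s'.card := by
  classical
  by_cases hvs : v ∈ s
  swap
  · exact ⟨s, subset_erase.2 ⟨hsA, hvs⟩, hs, le_rfl⟩
  by_cases hex : ∃ w ∈ A, G.Adj v w ∧ ∀ u ∈ s, u ≠ v → ¬ G.Adj w u
  · obtain ⟨w, hwA, hvw, hw⟩ := hex
    have hws : w ∉ s := fun h => hs v hvs w h hvw
    refine ⟨insert w (s.erase v), ?_, ?_, ?_⟩
    · intro x hx
      rcases mem_insert.1 hx with rfl | hx
      · exact mem_erase.2 ⟨hvw.ne', hwA⟩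
      · exact erase_subset_erase v hsA hx
    · intro a ha b hb hab
      rw [mem_insert, mem_erase] at ha hb
      rcases ha with rfl | ⟨hav, has⟩ <;> rcases hb with rfl | ⟨hbv, hbs⟩
      · exact G.loopless.irrefl _ hab
      · exact hw b hbs hbv hab
      · exact hw a has hav hab.symm
      · exact hs a has b hbs hab
    · rw [card_insert_of_notMem (fun h => hws (mem_of_mem_erase h)), card_erase_add_one hvs]
  push Not at hex
  exfalso
  have hclique : ∀ w ∈ A, G.Adj v w → ∀ w' ∈ A, G.Adj v w' → w ≠ w' → G.Adj w w' := by
    intro w hw hvw w' hw' hvw' hne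
    by_contra hadj
    obtain ⟨u, hu, huv, hwu⟩ := hex w hw hvw
    obtain ⟨u', hu', hu'v, hwu'⟩ := hex w' hw' hvw'
    have huw' : ¬ G.Adj u w' := fun h => hC4 <|
      nonempty_cycleGraph_four_embedding hvw hwu h hvw'.symm (hs v hvs u hu) hadj huv.symm hne
    have hwu'' : ¬ G.Adj w u' := fun h => hC4 <|
      nonempty_cycleGraph_four_embedding hvw h hwu'.symm hvw'.symm (hs v hvs u' hu') hadj
        hu'v.symm hne
    exact hP5 <| nonempty_pathGraph_five_embedding hwu.symm hvw.symm hvw' hwu'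
      (hs u hu v hvs) huw' (hs u hu u' hu') hadj hwu'' (hs v hvs u' hu')
  obtain ⟨w, hwA, hvw⟩ : ∃ w ∈ A, G.Adj v w := by
    obtain ⟨x, hx, y, hy, hxy⟩ := hedge
    have hpos : 0 < degIn G A v := by
      refine lt_of_lt_of_le ?_ (hmax x hx)
      rw [degIn_eq_card_filter]
      exact card_pos.2 ⟨y, mem_filter.2 ⟨hy, hxy⟩⟩
    rw [degIn_eq_card_filter] at hpos
    obtain ⟨w, hw⟩ := card_pos.1 hpos
    exact ⟨w, mem_filter.1 hw⟩
  obtain ⟨u, hu, huv, hwu⟩ := hex w hwA hvw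
  have hle := hmax w hwA
  rw [degIn_eq_card_filter, degIn_eq_card_filter] at hle
  have hsub : insert u (insert v (({y ∈ A | G.Adj v y} : Finset V).erase w)) ⊆
      ({y ∈ A | G.Adj w y} : Finset V) := by
    intro x hx
    simp only [mem_insert, mem_erase, mem_filter] at hx ⊢
    rcases hx with rfl | rfl | ⟨hxw, hxA, hvx⟩
    · exact ⟨hsA hu, hwu⟩
    · exact ⟨hv, hvw.symm⟩
    · exact ⟨hxA, hclique w hwA hvw x hxA hvx hxw.symm⟩
  have hcard := card_le_card hsub
  rw [card_insert_of_notMem (by simp [huv, hs v hvs u hu]), card_insert_of_notMem (by simp),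
    card_erase_add_one (by simp [hwA, hvw])] at hcard
  omega

/-- Barrus–Molnar: on a `{C₄, P₅}`-free graph, every Maxine run
produces a maximum independent set. -/
theorem maxine_of_C4_P5_free [Fintype V] [DecidableEq V] (G : SimpleGraph V)
    (hC4 : ¬ Nonempty (cycleGraph 4 ↪g G))
    (hP5 : ¬ Nonempty (pathGraph 5 ↪g G))
    (r : MaxineRun G) :
    (r.A r.t).card = indepNumOn G Finset.univ := by
  have key : ∀ i ≤ r.t, ∀ s, IsIndepF G s → ∃ s' ⊆ r.A i, IsIndepF G s' ∧ s.card ≤ s'.card := by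
    intro i
    induction i with
    | zero => exact fun _ s hs => ⟨s, by simp [r.init], hs, le_rfl⟩
    | succ i ih =>
      intro hi s hs
      obtain ⟨s₁, hs₁A, hs₁, hle₁⟩ := ih (by omega) s hs
      obtain ⟨s₂, hs₂A, hs₂, hle₂⟩ := exists_isIndepF_subset_erase hC4 hP5
        (r.hasEdge i hi) (r.mem_del i hi) (r.maxdeg i hi) hs₁A hs₁
      exact ⟨s₂, by rwa [r.step i hi], hs₂, hle₁.trans hle₂⟩
  symm
  refine IsGreatest.csSup_eq ⟨⟨r.A r.t, subset_univ _, r.final, rfl⟩, ?_⟩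
  rintro n ⟨s, -, hs, rfl⟩
  obtain ⟨s', hs'A, -, hle⟩ := key r.t le_rfl s hs
  exact hle.trans (card_le_card hs'A)
end

section
/- Let G be a finite simple graph, v a vertex with MDI conditions in G, and suppose v belongs to at least two distinct maximum independent sets of G. Then there exists a vertex subset W containing v such that in the induced subgraph G[W], v has MDI conditions, the degree of v in G[W] equals its degree in G, and G[W] has exactly one maximum independent set. -/
open SimpleGraph Finset

variable {V : Type*}

/-- `v` has MDI conditions in the subgraph of `G` induced on `A`:
`v` has maximum degree there and belongs to every maximum independent set. -/
def MDIOn (G : SimpleGraph V) (A : Finset V) (v : V) : Prop :=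
  v ∈ A ∧ (∀ y ∈ A, degIn G A y ≤ degIn G A v) ∧
    ∀ s : Finset V, MaxIndepOn G A s → v ∈ s

theorem IsIndepF.card_le_indepNumOn {G : SimpleGraph V} {A s : Finset V} (hs : IsIndepF G s)
    (hsA : s ⊆ A) : s.card ≤ indepNumOn G A :=
  le_csSup ⟨A.card, by rintro _ ⟨t, ht, -, rfl⟩; exact card_le_card ht⟩ ⟨s, hsA, hs, rfl⟩

theorem indepNumOn_mono (G : SimpleGraph V) {A B : Finset V} (h : A ⊆ B) :
    indepNumOn G A ≤ indepNumOn G B := by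
  refine csSup_le ⟨0, ∅, by simp, by simp [IsIndepF], rfl⟩ ?_
  rintro _ ⟨t, ht, hi, rfl⟩
  exact hi.card_le_indepNumOn (ht.trans h)

/-- If a maximum independent set of `G[B]` survives in `A ⊆ B`, then `G[A]` and `G[B]` have the
same independence number. -/
theorem MaxIndepOn.indepNumOn_eq {G : SimpleGraph V} {A B s : Finset V}
    (hs : MaxIndepOn G B s) (hsA : s ⊆ A) (hAB : A ⊆ B) : indepNumOn G A = indepNumOn G B :=
  (indepNumOn_mono G hAB).antisymm (hs.2.2 ▸ hs.2.1.card_le_indepNumOn hsA)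

theorem degIn_mono (G : SimpleGraph V) {A B : Finset V} (h : A ⊆ B) (x : V) :
    degIn G A x ≤ degIn G B x :=
  Set.ncard_le_ncard (fun _ hy => ⟨h hy.1, hy.2⟩) (B.finite_toSet.subset fun _ hy => hy.1)

/-- Lemma 3 in the paper: if `v` has MDI conditions and lies in two
distinct maximum independent sets, then there is an induced subgraph `G[W]` containing `v`
in which `v` still has MDI conditions, with the same degree at `v`, and which has exactly
one maximum independent set. -/
theorem exists_induced_unique_maxIndep [Fintype V] (G : SimpleGraph V) (v : V)
    (hMDI : MDIOn G Finset.univ v) (s₁ s₂ : Finset V)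
    (h₁ : MaxIndepOn G Finset.univ s₁) (h₂ : MaxIndepOn G Finset.univ s₂)
    (hne : s₁ ≠ s₂) (hv₁ : v ∈ s₁) (hv₂ : v ∈ s₂) :
    ∃ W : Finset V, v ∈ W ∧ MDIOn G W v ∧ degIn G W v = degIn G Finset.univ v ∧
      ∃! s : Finset V, MaxIndepOn G W s := by
  classical
  set W : Finset V := s₁ ∪ univ.filter (G.Adj v) with hW
  have hsW : s₁ ⊆ W := subset_union_left
  have hnum := h₁.indepNumOn_eq hsW (subset_univ W)
  have hdeg : degIn G W v = degIn G univ v := by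
    unfold degIn
    congr 1
    ext y
    simp +contextual [hW]
  have hmem : ∀ s, MaxIndepOn G W s → v ∈ s := fun s hs =>
    hMDI.2.2 s ⟨subset_univ s, hs.2.1, hs.2.2.trans hnum⟩
  refine ⟨W, hsW hv₁, ⟨hsW hv₁, fun y _ => ?_, hmem⟩, hdeg,
    s₁, ⟨hsW, h₁.2.1, h₁.2.2.trans hnum.symm⟩, fun s hs => ?_⟩
  · exact (degIn_mono G (subset_univ W) y).trans ((hMDI.2.1 y (mem_univ y)).trans hdeg.ge)
  · refine eq_of_subset_of_card_le (fun x hx => ?_) ?_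
    · rcases mem_union.mp (hs.1 hx) with h | h
      · exact h
      · exact absurd (mem_filter.mp h).2 (hs.2.1 v (hmem s hs) x hx)
    · rw [h₁.2.2, hs.2.2, hnum]
end

section
/- Let G be a finite simple graph with a unique maximum independent set of size 2, and suppose some vertex of G has MDI conditions. Then G has no edges (so G consists of exactly two isolated vertices). -/
open SimpleGraph Finset

variable {V : Type*}

/-- Two distinct nonadjacent vertices form a maximum independent set when the independence
number is two. -/
lemma maxIndepOn_univ_pair [Fintype V] [DecidableEq V] {G : SimpleGraph V}
    (h : indepNumOn G Finset.univ = 2) {a b : V} (hne : a ≠ b) (hab : ¬ G.Adj a b) :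
    MaxIndepOn G Finset.univ {a, b} := by
  refine ⟨Finset.subset_univ _, ?_, by rw [Finset.card_pair hne, h]⟩
  have hba : ¬ G.Adj b a := fun hba => hab hba.symm
  simp [IsIndepF, hab, hba]

lemma degIn_univ_add_card_le [Fintype V] {G : SimpleGraph V} {s : Finset V}
    (hs : IsIndepF G s) {v : V} (hv : v ∈ s) :
    degIn G Finset.univ v + s.card ≤ Fintype.card V := by
  have hsub : {y ∈ ((Finset.univ : Finset V) : Set V) | G.Adj v y} ⊆ (s : Set V)ᶜ :=
    fun y hy hys => hs v hv y hys hy.2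
  have hle := Set.ncard_le_ncard hsub
  have hcompl := Set.ncard_add_ncard_compl (s : Set V)
  rw [Set.ncard_coe_finset, Nat.card_eq_fintype_card] at hcompl
  unfold degIn
  omega

lemma degIn_univ_add_one_of_forall_adj [Fintype V] {G : SimpleGraph V} {x : V}
    (hx : ∀ y, x ≠ y → G.Adj x y) :
    degIn G Finset.univ x + 1 = Fintype.card V := by
  have heq : {y ∈ ((Finset.univ : Finset V) : Set V) | G.Adj x y} = {x}ᶜ := by
    ext y
    simpa using ⟨fun h => h.ne', fun h => hx y (Ne.symm h)⟩
  have hcompl := Set.ncard_add_ncard_compl ({x} : Set V)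
  rw [Set.ncard_singleton, Nat.card_eq_fintype_card] at hcompl
  rw [degIn, heq]
  omega

/-- a graph with a unique maximum independent set of size 2 and a vertex
with MDI conditions has no edges (it consists of exactly two isolated vertices). -/
theorem edgeless_of_unique_maxIndep_two [Fintype V] (G : SimpleGraph V)
    (I : Finset V) (v : V)
    (hI : MaxIndepOn G Finset.univ I) (hcard : I.card = 2)
    (huniq : ∀ J : Finset V, MaxIndepOn G Finset.univ J → J = I)
    (hMDI : MDIOn G Finset.univ v) :
    ∀ a b : V, ¬ G.Adj a b := by
  classical
  intro a b hab
  obtain ⟨-, hmax, hmem⟩ := hMDI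
  have hnum : indepNumOn G Finset.univ = 2 := hI.2.2 ▸ hcard
  obtain ⟨x, hx⟩ : ∃ x, x ∉ I := by
    by_contra! hall
    exact hI.2.1 a (hall a) b (hall b) hab
  have hxadj : ∀ y, x ≠ y → G.Adj x y := by
    intro y hne
    by_contra hxy
    exact hx (huniq _ (maxIndepOn_univ_pair hnum hne hxy) ▸ Finset.mem_insert_self x {y})
  have hdegv := degIn_univ_add_card_le hI.2.1 (hmem I hI)
  have hdegx := degIn_univ_add_one_of_forall_adj hxadj
  have hle := hmax x (Finset.mem_univ x)
  omega
end

section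
/- Let G be a finite simple graph whose unique maximum independent set is I = {u, v, w} (so α(G) = 3). If x, y ∈ N(v) are distinct vertices each adjacent to u and nonadjacent to w, then x and y are adjacent. (That is, Q_u = {x ∈ N(v) : x ∼ u, x ≁ w} induces a clique, and symmetrically so does Q_w.) -/
open SimpleGraph Finset

variable {V : Type*}

/-- if the unique maximum independent set is `{u, v, w}` (so `α(G) = 3`),
then any two distinct vertices of `N(v)` that are adjacent to `u` and nonadjacent to `w`
are adjacent; i.e. `Q_u` (and symmetrically `Q_w`) induces a clique. -/
theorem Qu_is_clique [Fintype V] [DecidableEq V] (G : SimpleGraph V) (u v w x y : V)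
    (huv : u ≠ v) (huw : u ≠ w) (hvw : v ≠ w)
    (hI : MaxIndepOn G Finset.univ {u, v, w})
    (huniq : ∀ J : Finset V, MaxIndepOn G Finset.univ J → J = {u, v, w})
    (hxy : x ≠ y)
    (hxv : G.Adj v x) (hxu : G.Adj x u) (hxw : ¬ G.Adj x w)
    (hyv : G.Adj v y) (hyu : G.Adj y u) (hyw : ¬ G.Adj y w) :
    G.Adj x y := by
  by_contra hadj
  have ne_w_of_adj_u : ∀ {z : V}, G.Adj z u → z ≠ w := by
    rintro z hz rfl
    exact hI.2.1 z (by simp) u (by simp) hz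
  have hxw' : x ≠ w := ne_w_of_adj_u hxu
  have hyw' : y ≠ w := ne_w_of_adj_u hyu
  have hJ : MaxIndepOn G Finset.univ {x, y, w} := by
    refine ⟨Finset.subset_univ _, ?_, ?_⟩
    · intro a ha b hb
      simp only [Finset.mem_insert, Finset.mem_singleton] at ha hb
      rcases ha with rfl | rfl | rfl <;> rcases hb with rfl | rfl | rfl <;>
        simp_all [G.adj_comm]
    · rw [← hI.2.2, Finset.card_eq_three.mpr ⟨x, y, w, hxy, hxw', hyw', rfl⟩,
        Finset.card_eq_three.mpr ⟨u, v, w, huv, huw, hvw, rfl⟩]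
  have hx : x ∈ ({u, v, w} : Finset V) := huniq _ hJ ▸ Finset.mem_insert_self x _
  simp only [Finset.mem_insert, Finset.mem_singleton] at hx
  rcases hx with h | h | h
  · exact hxu.ne h
  · exact hxv.ne h.symm
  · exact hxw' h
end

section
/- Let G be a finite simple graph, let {u, v, w} be an independent set, and suppose G contains no induced copy of the path P_5 whose center vertex is mapped to v. If x ∈ N(v) is adjacent to u and nonadjacent to w, and y ∈ N(v) is adjacent to w and nonadjacent to u, then x and y are adjacent. (That is, Q = Q_u ∪ Q_w induces a clique.) -/
open SimpleGraph Finset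

variable {V : Type*}

/-- if `{u, v, w}` is an independent set, `G` has no induced `P₅`
centered at `v`, `x ∈ N(v)` is adjacent to `u` but not `w`, and `y ∈ N(v)` is adjacent
to `w` but not `u`, then `x` and `y` are adjacent; i.e. `Q = Q_u ∪ Q_w` induces a clique. -/
theorem Q_is_clique [Fintype V] (G : SimpleGraph V) (u v w x y : V)
    (huv : u ≠ v) (huw : u ≠ w) (hvw : v ≠ w)
    (hau : ¬ G.Adj u v) (haw : ¬ G.Adj u w) (havw : ¬ G.Adj v w)
    (hP5 : ¬ ∃ f : pathGraph 5 ↪g G, f (2 : Fin 5) = v)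
    (hxv : G.Adj v x) (hxu : G.Adj x u) (hxw : ¬ G.Adj x w)
    (hyv : G.Adj v y) (hyw : G.Adj y w) (hyu : ¬ G.Adj y u) :
    G.Adj x y := by
  by_contra hxy
  have hux : u ≠ x := hxu.ne'
  have huy : u ≠ y := fun h => hau (h ▸ hyv.symm)
  have hxw' : x ≠ w := fun h => havw (h ▸ hxv)
  have hxy' : x ≠ y := fun h => hyu (h ▸ hxu)
  have hinj : Function.Injective ![u, x, v, y, w] := by
    intro i j h
    fin_cases i <;> fin_cases j <;>
      simp_all [hxv.ne, hxv.ne', hyv.ne, hyv.ne', hyw.ne, hyw.ne', eq_comm]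
  refine hP5 ⟨⟨⟨![u, x, v, y, w], hinj⟩, ?_⟩, rfl⟩
  intro i j
  fin_cases i <;> fin_cases j <;> simp_all [pathGraph_adj, G.adj_comm]
end
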